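/- arXiv:2010.01221 — 3 statements merged into one kernel-verified Lean document; each statement's English description precedes it below -/
import Mathlib

section
/- Let μ be a doubling measure on ℝⁿ, let p > 1 and α ≥ 0, and set φ_{p,α}(t) := t^p (1 + log⁺ t)^α where log⁺ u := max{log u, 0}. Then for every cube Q in ℝⁿ and every f ∈ BMO(dμ): ‖f − f_{Q,μ}‖_{φ_{p,α}(L)(Q, dμ/μ(Q))} ≤ c_μ 2^{n_μ} e 2^α (p + α + 1) ‖f‖_{BMO(dμ)}. -/
open MeasureTheory Set Filter
open scoped ENNReal

noncomputable section

/-- An axis-parallel cube in `ℝⁿ`, given by its lower corner and (positive) sidelength. -/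
structure Cube (n : ℕ) where
  corner : Fin n → ℝ
  side : ℝ
  side_pos : 0 < side

/-- The set of points of a cube. -/
def Cube.carrier {n : ℕ} (Q : Cube n) : Set (Fin n → ℝ) :=
  {x | ∀ i, Q.corner i ≤ x i ∧ x i ≤ Q.corner i + Q.side}

/-- A Borel measure on `ℝⁿ` is doubling with doubling constant `c ≥ 1` and doubling
dimension `d > 0`: every cube has finite positive measure and
`μ(Q̃) ≤ c (ℓ(Q̃)/ℓ(Q))^d μ(Q)` whenever `Q ⊆ Q̃`. -/
def IsDoubling {n : ℕ} (μ : Measure (Fin n → ℝ)) (c d : ℝ) : Prop :=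
  1 ≤ c ∧ 0 < d ∧ (∀ Q : Cube n, 0 < μ Q.carrier ∧ μ Q.carrier < ⊤) ∧
    ∀ Q Q' : Cube n, Q.carrier ⊆ Q'.carrier →
      μ Q'.carrier ≤ ENNReal.ofReal (c * (Q'.side / Q.side) ^ d) * μ Q.carrier

/-- `f_{Q,μ}`, the `μ`-average of `f` over the cube `Q`. -/
def cubeAvg {n : ℕ} (μ : Measure (Fin n → ℝ)) (Q : Cube n) (f : (Fin n → ℝ) → ℝ) : ℝ :=
  ⨍ x in Q.carrier, f x ∂μ

/-- The mean oscillation of `f` over the cube `Q`. -/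
def osc {n : ℕ} (μ : Measure (Fin n → ℝ)) (Q : Cube n) (f : (Fin n → ℝ) → ℝ) : ℝ :=
  ⨍ x in Q.carrier, |f x - cubeAvg μ Q f| ∂μ

/-- The `BMO(dμ)` norm: supremum of the mean oscillations over all cubes. -/
def bmoNorm {n : ℕ} (μ : Measure (Fin n → ℝ)) (f : (Fin n → ℝ) → ℝ) : ℝ :=
  ⨆ Q : Cube n, osc μ Q f

/-- Membership in `BMO(dμ)`: local integrability together with a finite supremum of
mean oscillations. -/
def MemBMO {n : ℕ} (μ : Measure (Fin n → ℝ)) (f : (Fin n → ℝ) → ℝ) : Prop :=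
  LocallyIntegrable f μ ∧ BddAbove (Set.range fun Q : Cube n => osc μ Q f)

/-- The local Luxemburg norm `‖f‖_{φ(L)(Q, dν/ν(Q))}`. -/
def luxNorm {n : ℕ} (φ : ℝ → ℝ) (ν : Measure (Fin n → ℝ)) (Q : Cube n)
    (f : (Fin n → ℝ) → ℝ) : ℝ :=
  sInf {l : ℝ | 0 < l ∧
    ∫⁻ x in Q.carrier, ENNReal.ofReal (φ (|f x| / l)) ∂ν ≤ ν Q.carrier}

/-- The local variable-exponent Luxemburg norm `‖f‖_{L^{p(·)}(Q, dx/|Q|)}`. -/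
def vpLuxNorm {n : ℕ} (p : (Fin n → ℝ) → ℝ) (Q : Cube n) (f : (Fin n → ℝ) → ℝ) : ℝ :=
  sInf {l : ℝ | 0 < l ∧
    ∫⁻ x in Q.carrier, ENNReal.ofReal ((|f x| / l) ^ p x) ≤ volume Q.carrier}

/-- The Young function `φ_{p,α}(t) = t^p (1 + log⁺ t)^α`. -/
def philog (p α : ℝ) (t : ℝ) : ℝ := t ^ p * (1 + max (Real.log t) 0) ^ α

namespace Cube

variable {n : ℕ}

lemma carrier_eq_closedBall (Q : Cube n) :
    Q.carrier = Metric.closedBall (fun i => Q.corner i + Q.side / 2) (Q.side / 2) := by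
  have h := Q.side_pos
  ext x
  rw [closedBall_pi _ (by positivity)]
  simp only [carrier, Set.mem_ofPred_eq, Set.mem_univ_pi, Real.closedBall_eq_Icc, Set.mem_Icc]
  refine forall_congr' fun i => ?_
  constructor <;> rintro ⟨h1, h2⟩ <;> constructor <;> linarith

lemma closedBall_eq_carrier (x : Fin n → ℝ) {r : ℝ} (hr : 0 < r) :
    Metric.closedBall x r = (Cube.mk (fun i => x i - r) (2 * r) (by positivity)).carrier := by
  rw [carrier_eq_closedBall]
  congr 1
  · ext i; simp
  · simp

lemma isCompact_carrier (Q : Cube n) : IsCompact Q.carrier := by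
  rw [carrier_eq_closedBall]
  exact isCompact_closedBall _ _

lemma measurableSet_carrier (Q : Cube n) : MeasurableSet Q.carrier :=
  Q.isCompact_carrier.measurableSet

/-- The index of the dyadic descendant of generation `k` of the half-open version of `Q`
(or of one of its translates) that contains `x`. -/
def dyadicIndex (Q : Cube n) (k : ℕ) (x : Fin n → ℝ) : Fin n → ℤ :=
  fun i => ⌊(x i - Q.corner i) / (Q.side / 2 ^ k)⌋

/-- The closed dyadic cube of generation `k` and index `m` in the grid generated by `Q`. -/
def dyadic (Q : Cube n) (k : ℕ) (m : Fin n → ℤ) : Cube n where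
  corner i := Q.corner i + m i * (Q.side / 2 ^ k)
  side := Q.side / 2 ^ k
  side_pos := div_pos Q.side_pos (by positivity)

lemma dyadicIndex_eq_iff (Q : Cube n) (k : ℕ) (x : Fin n → ℝ) (m : Fin n → ℤ) :
    Q.dyadicIndex k x = m ↔ ∀ i, (Q.dyadic k m).corner i ≤ x i ∧
      x i < (Q.dyadic k m).corner i + (Q.dyadic k m).side := by
  have h : 0 < Q.side / 2 ^ k := div_pos Q.side_pos (by positivity)
  rw [funext_iff]
  refine forall_congr' fun i => ?_
  simp only [dyadicIndex, dyadic, Int.floor_eq_iff, le_div_iff₀ h, div_lt_iff₀ h]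
  constructor <;> rintro ⟨h1, h2⟩ <;> constructor <;> linarith

lemma mem_dyadic_dyadicIndex (Q : Cube n) (k : ℕ) (x : Fin n → ℝ) :
    x ∈ (Q.dyadic k (Q.dyadicIndex k x)).carrier := fun i =>
  have h := (Q.dyadicIndex_eq_iff k x _).1 rfl i
  ⟨h.1, h.2.le⟩

lemma dyadic_zero_zero (Q : Cube n) : Q.dyadic 0 0 = Q := by
  simp [dyadic]

lemma dyadicIndex_succ (Q : Cube n) (k : ℕ) (x : Fin n → ℝ) (i : Fin n) :
    Q.dyadicIndex k x i = Q.dyadicIndex (k + 1) x i / 2 := by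
  have h : (x i - Q.corner i) / (Q.side / 2 ^ k)
      = (x i - Q.corner i) / (Q.side / 2 ^ (k + 1)) / ((2 : ℕ) : ℝ) := by
    have := Q.side_pos
    field_simp
    push_cast
    ring
  simp only [dyadicIndex]
  rw [h, Int.floor_div_natCast]
  rfl

lemma dyadicIndex_eq_of_le (Q : Cube n) {j k : ℕ} (hjk : j ≤ k) {x y : Fin n → ℝ}
    (h : Q.dyadicIndex k x = Q.dyadicIndex k y) : Q.dyadicIndex j x = Q.dyadicIndex j y := by
  induction k, hjk using Nat.le_induction with
  | base => exact h
  | succ k _ ih =>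
    refine ih (funext fun i => ?_)
    rw [dyadicIndex_succ Q k x, dyadicIndex_succ Q k y, h]

lemma dyadic_succ_subset (Q : Cube n) (k : ℕ) (x : Fin n → ℝ) :
    (Q.dyadic (k + 1) (Q.dyadicIndex (k + 1) x)).carrier ⊆
      (Q.dyadic k (Q.dyadicIndex k x)).carrier := by
  intro y hy i
  obtain ⟨h1, h2⟩ := hy i
  have hs : 0 < Q.side / 2 ^ (k + 1) := div_pos Q.side_pos (by positivity)
  have hs' : Q.side / 2 ^ k = 2 * (Q.side / 2 ^ (k + 1)) := by
    field_simp
    ring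
  simp only [dyadic, hs'] at h1 h2 ⊢
  have e := Q.dyadicIndex_succ k x i
  have a1 : 2 * Q.dyadicIndex k x i ≤ Q.dyadicIndex (k + 1) x i := by omega
  have a2 : Q.dyadicIndex (k + 1) x i ≤ 2 * Q.dyadicIndex k x i + 1 := by omega
  have b1 : 2 * (Q.dyadicIndex k x i : ℝ) ≤ Q.dyadicIndex (k + 1) x i := by exact_mod_cast a1
  have b2 : (Q.dyadicIndex (k + 1) x i : ℝ) ≤ 2 * Q.dyadicIndex k x i + 1 := by exact_mod_cast a2
  have c1 := mul_le_mul_of_nonneg_right b1 hs.le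
  have c2 := mul_le_mul_of_nonneg_right b2 hs.le
  constructor <;> linarith

lemma measurableSet_dyadicIndex_eq (Q : Cube n) (k : ℕ) (m : Fin n → ℤ) :
    MeasurableSet {x | Q.dyadicIndex k x = m} := by
  simp only [dyadicIndex_eq_iff, Set.ofPred_forall]
  refine MeasurableSet.iInter fun i => ?_
  exact (measurableSet_le measurable_const (measurable_pi_apply i)).inter
    (measurableSet_lt (measurable_pi_apply i) measurable_const)

end Cube

namespace IsDoubling

variable {n : ℕ} {μ : Measure (Fin n → ℝ)} {c d : ℝ}

lemma isLocallyFiniteMeasure (hμ : IsDoubling μ c d) : IsLocallyFiniteMeasure μ where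
  finiteAtNhds x := by
    refine ⟨Metric.closedBall x 1, Metric.closedBall_mem_nhds x one_pos, ?_⟩
    rw [Cube.closedBall_eq_carrier x one_pos]
    exact (hμ.2.2.1 _).2

lemma isUnifLocDoublingMeasure (hμ : IsDoubling μ c d) : IsUnifLocDoublingMeasure μ where
  exists_measure_closedBall_le_mul'' := by
    refine ⟨(c * 2 ^ d).toNNReal, ?_⟩
    filter_upwards [self_mem_nhdsWithin] with r (hr : 0 < r) x
    have h2r : 0 < 2 * r := by positivity
    have hsub := Metric.closedBall_subset_closedBall (x := x) (show r ≤ 2 * r by linarith)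
    rw [Cube.closedBall_eq_carrier x hr, Cube.closedBall_eq_carrier x h2r] at hsub ⊢
    have h := hμ.2.2.2 _ _ hsub
    simp only at h
    rwa [mul_div_assoc, div_self h2r.ne', mul_one] at h

lemma measure_hyperplane (hμ : IsDoubling μ c d) (i : Fin n) (a : ℝ) :
    μ {x | x i = a} = 0 := by
  have := hμ.isLocallyFiniteMeasure
  obtain ⟨hc, hd, hfin, hdoub⟩ := hμ
  set H : Set (Fin n → ℝ) := {x | x i = a} with hH
  have hHm : MeasurableSet H := measurableSet_eq_fun (measurable_pi_apply i) measurable_const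
  set C : ℝ≥0∞ := ENNReal.ofReal (c * 4 ^ d) with hC
  have key : ∀ x ∈ H, ∀ r > 0,
      μ (H ∩ Metric.closedBall x r) / μ (Metric.closedBall x r) ≤ 1 - C⁻¹ := by
    intro x hx r hr
    have hr2 : 0 < r / 2 := by positivity
    let P : Cube n := ⟨fun j => x j + r / 2, r / 2, hr2⟩
    have hball := Cube.closedBall_eq_carrier x hr
    have hP : P.carrier ⊆ Metric.closedBall x r := by
      rw [hball]
      intro y hy j
      obtain ⟨h1, h2⟩ := hy j
      simp only [P] at h1 h2
      constructor <;> simp only <;> linarith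
    have hdisj : Disjoint (H ∩ Metric.closedBall x r) P.carrier := by
      rw [Set.disjoint_left]
      rintro y ⟨hy, -⟩ hyP
      have h1 := (hyP i).1
      simp only [P] at h1
      have hy' : y i = a := hy
      have hx' : x i = a := hx
      linarith
    have hsum : μ (H ∩ Metric.closedBall x r) + μ P.carrier ≤ μ (Metric.closedBall x r) := by
      rw [← measure_union hdisj P.measurableSet_carrier]
      exact measure_mono (Set.union_subset Set.inter_subset_right hP)
    have hpos : 0 < μ (Metric.closedBall x r) := by rw [hball]; exact (hfin _).1
    have hlt : μ (Metric.closedBall x r) < ⊤ := by rw [hball]; exact (hfin _).2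
    have hd' : μ (Metric.closedBall x r) ≤ C * μ P.carrier := by
      rw [hball] at hP ⊢
      have h := hdoub P _ hP
      have e : 2 * r / P.side = 4 := by simp only [P]; field_simp; norm_num
      simp only at h
      rwa [e] at h
    have hC0 : C ≠ 0 := by
      rw [hC]; exact (ENNReal.ofReal_pos.2 (by positivity)).ne'
    have hCi : C⁻¹ ≤ μ P.carrier / μ (Metric.closedBall x r) := by
      rw [ENNReal.le_div_iff_mul_le (Or.inl hpos.ne') (Or.inl hlt.ne), mul_comm,
        ← div_eq_mul_inv]
      exact ENNReal.div_le_of_le_mul' hd'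
    refine ENNReal.le_sub_of_add_le_right (ENNReal.inv_ne_top.2 hC0) ?_
    calc _ ≤ μ (H ∩ Metric.closedBall x r) / μ (Metric.closedBall x r)
          + μ P.carrier / μ (Metric.closedBall x r) := by gcongr
      _ = (μ (H ∩ Metric.closedBall x r) + μ P.carrier) / μ (Metric.closedBall x r) :=
          (ENNReal.add_div).symm
      _ ≤ 1 := ENNReal.div_le_of_le_mul (by rwa [one_mul])
  have hae : ∀ᵐ x ∂μ.restrict H, False := by
    filter_upwards [Besicovitch.ae_tendsto_measure_inter_div μ H, ae_restrict_mem hHm]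
      with x hx hxH
    have h1 : (1 : ℝ≥0∞) ≤ 1 - C⁻¹ :=
      le_of_tendsto hx (by
        filter_upwards [self_mem_nhdsWithin] with r hr using key x hxH r hr)
    exact absurd h1 (not_le.2 (ENNReal.sub_lt_self ENNReal.one_ne_top one_ne_zero
      (ENNReal.inv_ne_zero.2 ENNReal.ofReal_ne_top)))
  simpa [ae_iff] using hae

lemma dyadicIndex_eq_ae_eq (hμ : IsDoubling μ c d) (Q : Cube n) (k : ℕ) (m : Fin n → ℤ) :
    {x | Q.dyadicIndex k x = m} =ᵐ[μ] (Q.dyadic k m).carrier := by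
  have hnull : ∀ᵐ x ∂μ, ∀ i, x i ≠ (Q.dyadic k m).corner i + (Q.dyadic k m).side := by
    refine ae_all_iff.2 fun i => ?_
    rw [ae_iff]
    simpa using hμ.measure_hyperplane i _
  refine Filter.eventuallyEq_set.2 ?_
  filter_upwards [hnull] with x hx
  rw [Cube.dyadicIndex_eq_iff]
  exact forall_congr' fun i =>
    ⟨fun h => ⟨h.1, h.2.le⟩, fun h => ⟨h.1, lt_of_le_of_ne h.2 (hx i)⟩⟩

lemma lintegral_carrier_eq (hμ : IsDoubling μ c d) (Q : Cube n) {g : (Fin n → ℝ) → ℝ}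
    (hg : LocallyIntegrable g μ) (hg0 : 0 ≤ g) :
    ∫⁻ x in Q.carrier, ENNReal.ofReal (g x) ∂μ
      = ENNReal.ofReal (⨍ x in Q.carrier, g x ∂μ) * μ Q.carrier := by
  have hfin := hμ.2.2.1 Q
  have hint := hg.integrableOn_isCompact Q.isCompact_carrier
  have hpos : 0 < μ.real Q.carrier := ENNReal.toReal_pos hfin.1.ne' hfin.2.ne
  rw [← ofReal_integral_eq_lintegral_ofReal hint (ae_of_all _ hg0), setAverage_eq, smul_eq_mul,
    ← ENNReal.ofReal_toReal hfin.2.ne, ← Measure.real, ← ENNReal.ofReal_mul (by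
      have : 0 ≤ ∫ x in Q.carrier, g x ∂μ := integral_nonneg hg0
      positivity)]
  congr 1
  field_simp

end IsDoubling

namespace IsDoubling

variable {n : ℕ} {μ : Measure (Fin n → ℝ)} {c d : ℝ}

lemma setAverage_nonneg (Q : Cube n) {g : (Fin n → ℝ) → ℝ} (hg0 : 0 ≤ g) :
    0 ≤ ⨍ x in Q.carrier, g x ∂μ := by
  rw [setAverage_eq, smul_eq_mul]
  exact mul_nonneg (by positivity) (integral_nonneg hg0)

lemma setAverage_le_iff (hμ : IsDoubling μ c d) (Q : Cube n) {g : (Fin n → ℝ) → ℝ}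
    (hg : LocallyIntegrable g μ) (hg0 : 0 ≤ g) {l : ℝ} (hl : 0 ≤ l) :
    ⨍ x in Q.carrier, g x ∂μ ≤ l ↔
      ∫⁻ x in Q.carrier, ENNReal.ofReal (g x) ∂μ ≤ ENNReal.ofReal l * μ Q.carrier := by
  have hfin := hμ.2.2.1 Q
  rw [hμ.lintegral_carrier_eq Q hg hg0, ENNReal.mul_le_mul_iff_left hfin.1.ne' hfin.2.ne,
    ENNReal.ofReal_le_ofReal_iff hl]

lemma ae_tendsto_average_dyadic (hμ : IsDoubling μ c d) {g : (Fin n → ℝ) → ℝ}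
    (hg : LocallyIntegrable g μ) (Q : Cube n) :
    ∀ᵐ x ∂μ, Tendsto (fun k => ⨍ y in (Q.dyadic k (Q.dyadicIndex k x)).carrier, g y ∂μ)
      atTop (nhds (g x)) := by
  have := hμ.isLocallyFiniteMeasure
  have := hμ.isUnifLocDoublingMeasure
  filter_upwards [IsUnifLocDoublingMeasure.ae_tendsto_average μ hg 1] with x hx
  simp only [Cube.carrier_eq_closedBall]
  refine hx _ _ ?_ (Eventually.of_forall fun k => ?_)
  · refine tendsto_nhdsWithin_iff.2 ⟨?_, Eventually.of_forall fun k =>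
      half_pos (Q.dyadic k (Q.dyadicIndex k x)).side_pos⟩
    have h : Tendsto (fun k : ℕ => Q.side / 2 * (1 / 2 : ℝ) ^ k) atTop (nhds (Q.side / 2 * 0)) :=
      (tendsto_pow_atTop_nhds_zero_of_lt_one (by norm_num) (by norm_num)).const_mul _
    rw [mul_zero] at h
    refine h.congr fun k => ?_
    simp only [Cube.dyadic, one_div, inv_pow]
    ring
  · rw [one_mul, ← Cube.carrier_eq_closedBall]
    exact Q.mem_dyadic_dyadicIndex k x

/-- The Calderón–Zygmund decomposition of `g` at height `l` with respect to the dyadic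
subcubes of `Q`. -/
theorem exists_calderonZygmund (hμ : IsDoubling μ c d) {g : (Fin n → ℝ) → ℝ}
    (hg : LocallyIntegrable g μ) (hg0 : 0 ≤ g) (Q : Cube n) {l : ℝ} (hl : 0 < l)
    (hQ : ⨍ x in Q.carrier, g x ∂μ ≤ l) :
    ∃ T : Set (ℕ × (Fin n → ℤ)),
      (∀ᵐ x ∂μ, x ∈ Q.carrier → l < g x → ∃ t ∈ T, x ∈ (Q.dyadic t.1 t.2).carrier) ∧
      ENNReal.ofReal l * ∑' t : T, μ (Q.dyadic t.1.1 t.1.2).carrier ≤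
        ∫⁻ x in Q.carrier, ENNReal.ofReal (g x) ∂μ ∧
      ∀ t ∈ T, ⨍ x in (Q.dyadic t.1 t.2).carrier, g x ∂μ ≤ c * 2 ^ d * l := by
  have hc : 0 < c := one_pos.trans_le hμ.1
  let avg (k : ℕ) (m : Fin n → ℤ) : ℝ := ⨍ x in (Q.dyadic k m).carrier, g x ∂μ
  let T : Set (ℕ × (Fin n → ℤ)) := {t | ∃ x, Q.dyadicIndex 0 x = 0 ∧ Q.dyadicIndex t.1 x = t.2 ∧
    l < avg t.1 (Q.dyadicIndex t.1 x) ∧ ∀ j < t.1, avg j (Q.dyadicIndex j x) ≤ l}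
  refine ⟨T, ?_, ?_, ?_⟩
  · have h0 := (hμ.dyadicIndex_eq_ae_eq Q 0 0).mem_iff
    rw [Cube.dyadic_zero_zero] at h0
    filter_upwards [h0, hμ.ae_tendsto_average_dyadic hg Q] with x hx0 hx hxQ hlx
    have hex : ∃ k, l < avg k (Q.dyadicIndex k x) :=
      (hx.eventually (lt_mem_nhds hlx)).exists
    classical
    exact ⟨(Nat.find hex, Q.dyadicIndex (Nat.find hex) x),
      ⟨x, hx0.2 hxQ, rfl, Nat.find_spec hex, fun j hj => not_lt.1 (Nat.find_min hex hj)⟩,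
      Q.mem_dyadic_dyadicIndex _ x⟩
  · have hlt : ∀ s ∈ T, ∀ t ∈ T, ∀ x, Q.dyadicIndex s.1 x = s.2 → Q.dyadicIndex t.1 x = t.2 →
        ¬ s.1 < t.1 := by
      rintro s ⟨y, -, hy, hly, -⟩ t ⟨z, -, hz, -, hlz⟩ x hxs hxt hst
      have h := hlz _ hst
      rw [Q.dyadicIndex_eq_of_le hst.le (hz.trans hxt.symm), hxs, ← hy] at h
      exact absurd hly (not_lt.2 h)
    have hdisj : Pairwise (Function.onFun Disjoint
        fun t : T => {x | Q.dyadicIndex t.1.1 x = t.1.2}) := by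
      intro s t hst
      refine Set.disjoint_left.2 fun x hxs hxt => hst ?_
      have h : s.1.1 = t.1.1 := le_antisymm
        (not_lt.1 (hlt t t.2 s s.2 x hxt hxs)) (not_lt.1 (hlt s s.2 t t.2 x hxs hxt))
      have hxs' : Q.dyadicIndex s.1.1 x = s.1.2 := hxs
      have hxt' : Q.dyadicIndex t.1.1 x = t.1.2 := hxt
      exact Subtype.ext (Prod.ext h (by rw [← hxs', ← hxt', h]))
    have hsub : ⋃ t : T, {x | Q.dyadicIndex t.1.1 x = t.1.2} ⊆ Q.carrier := by
      refine Set.iUnion_subset ?_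
      rintro ⟨t, y, hy0, hy, hly⟩ x hx
      have hx' : Q.dyadicIndex t.1 x = t.2 := hx
      have h0 := Q.dyadicIndex_eq_of_le (Nat.zero_le _) (hy.trans hx'.symm)
      have h := Q.mem_dyadic_dyadicIndex 0 x
      rwa [← h0, hy0, Cube.dyadic_zero_zero] at h
    rw [← ENNReal.tsum_mul_left]
    calc ∑' t : T, ENNReal.ofReal l * μ (Q.dyadic t.1.1 t.1.2).carrier
        ≤ ∑' t : T, ∫⁻ x in {x | Q.dyadicIndex t.1.1 x = t.1.2}, ENNReal.ofReal (g x) ∂μ := by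
          refine ENNReal.tsum_le_tsum ?_
          rintro ⟨t, y, -, hy, hly, -⟩
          rw [hy] at hly
          rw [setLIntegral_congr (hμ.dyadicIndex_eq_ae_eq Q t.1 t.2),
            hμ.lintegral_carrier_eq _ hg hg0]
          gcongr
      _ = ∫⁻ x in ⋃ t : T, {x | Q.dyadicIndex t.1.1 x = t.1.2}, ENNReal.ofReal (g x) ∂μ :=
          (lintegral_iUnion (fun t => Q.measurableSet_dyadicIndex_eq _ _) hdisj _).symm
      _ ≤ _ := lintegral_mono_set hsub
  · rintro ⟨k, m⟩ ⟨y, hy0, hy, hly, hly'⟩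
    simp only at hy hly hly' ⊢
    subst hy
    cases k with
    | zero =>
      rw [hy0] at hly
      simp only [avg, Cube.dyadic_zero_zero] at hly
      exact absurd hQ (not_le.2 hly)
    | succ k =>
      have hsub := Q.dyadic_succ_subset k y
      have hpar := (hμ.setAverage_le_iff _ hg hg0 hl.le).1 (hly' k k.lt_succ_self)
      have hdoub := hμ.2.2.2 _ _ hsub
      have hside : (Q.dyadic k (Q.dyadicIndex k y)).side /
          (Q.dyadic (k + 1) (Q.dyadicIndex (k + 1) y)).side = 2 := by
        have := Q.side_pos
        simp only [Cube.dyadic]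
        field_simp
        ring
      rw [hside] at hdoub
      rw [hμ.setAverage_le_iff _ hg hg0 (by positivity)]
      calc _ ≤ _ := lintegral_mono_set hsub
        _ ≤ _ := hpar
        _ ≤ ENNReal.ofReal l * (ENNReal.ofReal (c * 2 ^ d) *
            μ (Q.dyadic (k + 1) (Q.dyadicIndex (k + 1) y)).carrier) := by gcongr
        _ = _ := by
          rw [← mul_assoc, mul_comm (c * 2 ^ d), ENNReal.ofReal_mul hl.le]

lemma abs_cubeAvg_sub_le (hμ : IsDoubling μ c d) {f : (Fin n → ℝ) → ℝ}
    (hf : LocallyIntegrable f μ) (P : Cube n) (a : ℝ) :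
    |cubeAvg μ P f - a| ≤ ⨍ x in P.carrier, |f x - a| ∂μ := by
  have hfin := hμ.2.2.1 P
  have hint := hf.integrableOn_isCompact P.isCompact_carrier
  have hpos : 0 < μ.real P.carrier := ENNReal.toReal_pos hfin.1.ne' hfin.2.ne
  have hconst : IntegrableOn (fun _ : Fin n → ℝ => a) P.carrier μ :=
    integrableOn_const hfin.2.ne
  have h : cubeAvg μ P f - a = (μ.real P.carrier)⁻¹ * ∫ x in P.carrier, (f x - a) ∂μ := by
    rw [cubeAvg, setAverage_eq, integral_sub hint hconst, setIntegral_const, smul_eq_mul,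
      smul_eq_mul]
    field_simp
  rw [h, setAverage_eq, smul_eq_mul, abs_mul, abs_of_pos (inv_pos.2 hpos)]
  gcongr
  exact abs_integral_le_integral_abs

/-- The John–Nirenberg inequality, along the integer multiples of `c * 2 ^ d * e * B`. -/
theorem measure_lt_abs_sub_cubeAvg_le (hμ : IsDoubling μ c d) {f : (Fin n → ℝ) → ℝ}
    (hf : LocallyIntegrable f μ) {B : ℝ} (hB : 0 < B) (hosc : ∀ Q : Cube n, osc μ Q f ≤ B)
    (k : ℕ) (Q : Cube n) :
    μ {x ∈ Q.carrier | k * (c * 2 ^ d * (Real.exp 1 * B)) < |f x - cubeAvg μ Q f|} ≤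
      ENNReal.ofReal (Real.exp (-k)) * μ Q.carrier := by
  have := hμ.isLocallyFiniteMeasure
  have he : 1 < Real.exp 1 := Real.one_lt_exp_iff.2 one_pos
  have hA : 1 ≤ c * 2 ^ d :=
    one_le_mul_of_one_le_of_one_le hμ.1 (Real.one_le_rpow (by norm_num) hμ.2.1.le)
  set A := c * 2 ^ d with hA_def
  set l := Real.exp 1 * B with hl_def
  have hl : 0 < l := by positivity
  have hlA : l ≤ A * l := le_mul_of_one_le_left hl.le hA
  induction k generalizing Q with
  | zero =>
    simp only [Nat.cast_zero, neg_zero, Real.exp_zero, ENNReal.ofReal_one, one_mul]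
    exact measure_mono fun x hx => hx.1
  | succ k ih =>
    set a := cubeAvg μ Q f with ha
    have hg0 : 0 ≤ fun x => |f x - a| := fun x => abs_nonneg _
    have hg : LocallyIntegrable (fun x => |f x - a|) μ :=
      fun x => (hf.sub (locallyIntegrable_const a) x).imp fun _ h => ⟨h.1, h.2.norm⟩
    have hBl : B ≤ l := le_mul_of_one_le_left hB.le he.le
    obtain ⟨T, hcov, hsum, havg⟩ :=
      hμ.exists_calderonZygmund hg hg0 Q hl ((hosc Q).trans hBl)
    have hsum' : ∑' t : T, μ (Q.dyadic t.1.1 t.1.2).carrier ≤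
        ENNReal.ofReal (Real.exp (-1)) * μ Q.carrier := by
      have h1 := hsum.trans ((hμ.setAverage_le_iff Q hg hg0 hB.le).1 (hosc Q))
      have h2 : B = l * Real.exp (-1) := by
        rw [hl_def, mul_right_comm, ← Real.exp_add]
        simp
      rw [h2, ENNReal.ofReal_mul hl.le, mul_assoc] at h1
      exact (ENNReal.mul_le_mul_iff_right (ENNReal.ofReal_pos.2 hl).ne' ENNReal.ofReal_ne_top).1 h1
    have hsub : {x ∈ Q.carrier | ((k + 1 : ℕ) : ℝ) * (A * l) < |f x - a|} ≤ᵐ[μ]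
        ⋃ t : T, {x ∈ (Q.dyadic t.1.1 t.1.2).carrier |
          k * (A * l) < |f x - cubeAvg μ (Q.dyadic t.1.1 t.1.2) f|} := by
      filter_upwards [hcov] with x hx hxS
      obtain ⟨hxQ, hxl⟩ := hxS
      push_cast at hxl
      have hk : 0 ≤ (k : ℝ) * (A * l) := by positivity
      obtain ⟨t, htT, hxt⟩ := hx hxQ (by linarith)
      refine Set.mem_iUnion.2 ⟨⟨t, htT⟩, hxt, ?_⟩
      have h1 := (hμ.abs_cubeAvg_sub_le hf (Q.dyadic t.1 t.2) a).trans (havg t htT)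
      have h2 := abs_sub_le (f x) (cubeAvg μ (Q.dyadic t.1 t.2) f) a
      simp only
      linarith
    calc _ ≤ _ := measure_mono_ae hsub
      _ ≤ ∑' t : T, _ := measure_iUnion_le _
      _ ≤ ∑' t : T, ENNReal.ofReal (Real.exp (-k)) * μ (Q.dyadic t.1.1 t.1.2).carrier :=
        ENNReal.tsum_le_tsum fun t => ih _
      _ ≤ ENNReal.ofReal (Real.exp (-k)) * (ENNReal.ofReal (Real.exp (-1)) * μ Q.carrier) := by
        rw [ENNReal.tsum_mul_left]
        gcongr
      _ = _ := by
        rw [← mul_assoc, ← ENNReal.ofReal_mul (Real.exp_pos _).le, ← Real.exp_add]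
        congr 3
        push_cast
        ring

end IsDoubling

lemma Real.Gamma_add_one_le_rpow_self {q : ℝ} (hq : 1 ≤ q) : Real.Gamma (q + 1) ≤ q ^ q := by
  have base : ∀ q : ℝ, 1 ≤ q → q ≤ 2 → Real.Gamma (q + 1) ≤ q ^ q := by
    intro q h1 h2
    have hG : Real.Gamma q ≤ 1 := by
      have h := Real.convexOn_Gamma.2 (Set.mem_Ioi.2 one_pos) (Set.mem_Ioi.2 two_pos)
        (show 0 ≤ 2 - q by linarith) (show 0 ≤ q - 1 by linarith) (by ring)
      simp only [smul_eq_mul, Real.Gamma_one, Real.Gamma_two] at h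
      have e : (2 - q) * 1 + (q - 1) * 2 = q := by ring
      rw [e] at h
      linarith
    rw [Real.Gamma_add_one (by linarith)]
    calc q * Real.Gamma q ≤ q * 1 := by gcongr
      _ = q ^ (1 : ℝ) := by simp
      _ ≤ q ^ q := Real.rpow_le_rpow_of_exponent_le h1 h1
  have step : ∀ N : ℕ, ∀ q : ℝ, 1 ≤ q → q ≤ 2 + N → Real.Gamma (q + 1) ≤ q ^ q := by
    intro N
    induction N with
    | zero => intro q h1 h2; exact base q h1 (by simpa using h2)
    | succ N ih =>
      intro q h1 h2
      rcases le_total q 2 with h | h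
      · exact base q h1 h
      push_cast at h2
      have h3 := ih (q - 1) (by linarith) (by linarith)
      rw [sub_add_cancel] at h3
      rw [Real.Gamma_add_one (by linarith)]
      calc q * Real.Gamma q ≤ q * (q - 1) ^ (q - 1) := by gcongr
        _ ≤ q * q ^ (q - 1) := by
          gcongr
          linarith
        _ = q ^ q := by
          rw [Real.rpow_sub_one (by linarith)]
          field_simp
  obtain ⟨N, hN⟩ := exists_nat_ge q
  exact step N q hq (by linarith)

lemma MeasureTheory.lintegral_rpow_le_of_exp_tail {X : Type*} [MeasurableSpace X] {ν : Measure X}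
    {Y : X → ℝ} (hY0 : 0 ≤ Y) (hY : AEMeasurable Y ν) {M : ℝ≥0∞}
    (htail : ∀ t > 0, ν {x | t < Y x} ≤ ENNReal.ofReal (Real.exp (-t)) * M) {q : ℝ}
    (hq : 0 < q) :
    ∫⁻ x, ENNReal.ofReal (Y x ^ q) ∂ν ≤ ENNReal.ofReal (Real.Gamma (q + 1)) * M := by
  rw [lintegral_rpow_eq_lintegral_meas_lt_mul ν (ae_of_all _ hY0) hY hq]
  have hG : ∫⁻ t in Set.Ioi (0 : ℝ), ENNReal.ofReal (Real.exp (-t) * t ^ (q - 1))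
      = ENNReal.ofReal (Real.Gamma q) := by
    rw [Real.Gamma_eq_integral hq, ofReal_integral_eq_lintegral_ofReal
      (Real.GammaIntegral_convergent hq)]
    filter_upwards [ae_restrict_mem measurableSet_Ioi] with t (ht : 0 < t)
    show 0 ≤ Real.exp (-t) * t ^ (q - 1)
    positivity
  calc ENNReal.ofReal q * ∫⁻ t in Set.Ioi (0 : ℝ), ν {x | t < Y x} * ENNReal.ofReal (t ^ (q - 1))
      ≤ ENNReal.ofReal q *
          ∫⁻ t in Set.Ioi (0 : ℝ), ENNReal.ofReal (Real.exp (-t) * t ^ (q - 1)) * M := by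
        gcongr 1
        refine setLIntegral_mono' measurableSet_Ioi fun t ht => ?_
        rw [ENNReal.ofReal_mul (Real.exp_pos _).le, mul_right_comm]
        gcongr
        exact htail t ht
    _ = ENNReal.ofReal (Real.Gamma (q + 1)) * M := by
        rw [lintegral_mul_const _ (by fun_prop), hG, ← mul_assoc, ← ENNReal.ofReal_mul hq.le,
          Real.Gamma_add_one hq.ne']

lemma Real.rpow_le_affine_rpow {y a q : ℝ} (hy : 0 ≤ y) (ha : 0 ≤ a) (hq : 0 < q) (haq : a ≤ q) :
    y ^ a ≤ (1 - a / q) + a / q * y ^ q := by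
  have h1 : a / q ≤ 1 := (div_le_one hq).2 haq
  have h := Real.geom_mean_le_arith_mean2_weighted (sub_nonneg.2 h1) (div_nonneg ha hq.le)
    zero_le_one (Real.rpow_nonneg hy q) (by ring)
  rwa [Real.one_rpow, one_mul, mul_one, ← Real.rpow_mul hy, mul_div_cancel₀ _ hq.ne'] at h

lemma one_add_log_rpow_le {u α : ℝ} (hu : 1 ≤ u) (hα : 0 ≤ α) :
    (1 + Real.log u) ^ α ≤ 2 ^ α * Real.exp (-(α / 2)) * u ^ (α / 2) := by
  have hl := Real.log_nonneg hu
  have hu0 : 0 < u := by linarith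
  have h : 1 + Real.log u ≤ 2 * Real.exp ((Real.log u - 1) / 2) := by
    have := Real.add_one_le_exp ((Real.log u - 1) / 2)
    linarith
  calc (1 + Real.log u) ^ α ≤ (2 * Real.exp ((Real.log u - 1) / 2)) ^ α := by gcongr
    _ = 2 ^ α * Real.exp (-(α / 2)) * u ^ (α / 2) := by
      rw [Real.mul_rpow (by norm_num) (Real.exp_pos _).le, ← Real.exp_mul,
        Real.rpow_def_of_pos hu0, mul_assoc, ← Real.exp_add]
      ring_nf

lemma philog_div_two_rpow_le {p α y : ℝ} (hp : 1 < p) (hα : 0 ≤ α) (hy : 0 ≤ y) :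
    philog p α (y / 2 ^ α) ≤ Real.exp (-(α / 2)) *
      ((1 - p / (p + α)) + (p + α / 2) / (p + α) * y ^ (p + α)) := by
  have hq : 0 < p + α := by linarith
  have h2 : (0 : ℝ) < 2 ^ α := by positivity
  have hyq := Real.rpow_nonneg hy (p + α)
  have hmono : p / (p + α) ≤ (p + α / 2) / (p + α) := by gcongr; linarith
  have hcoef : ((2 : ℝ) ^ α)⁻¹ ≤ Real.exp (-(α / 2)) := by
    rw [← Real.rpow_neg (by norm_num), Real.rpow_def_of_pos (by norm_num), Real.exp_le_exp]
    have := Real.log_two_gt_d9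
    nlinarith
  have h2α : (1 : ℝ) ≤ 2 ^ α := Real.one_le_rpow (by norm_num) hα
  have hs : ((2 : ℝ) ^ α) ^ p ≥ 2 ^ α := by
    conv_rhs => rw [← Real.rpow_one (2 ^ α)]
    exact Real.rpow_le_rpow_of_exponent_le h2α hp.le
  unfold philog
  rcases le_or_gt (y / 2 ^ α) 1 with hu | hu
  · have hlog : max (Real.log (y / 2 ^ α)) 0 = 0 :=
      max_eq_right (Real.log_nonpos (by positivity) hu)
    rw [hlog, add_zero, Real.one_rpow, mul_one, Real.div_rpow hy h2.le, div_eq_inv_mul]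
    have h1 := Real.rpow_le_affine_rpow hy (by linarith : 0 ≤ p) hq (by linarith)
    have h3 : ((2 ^ α) ^ p)⁻¹ ≤ Real.exp (-(α / 2)) := (inv_anti₀ h2 hs).trans hcoef
    refine mul_le_mul h3 (h1.trans ?_) (by positivity) (Real.exp_pos _).le
    gcongr
  · have hu0 : 0 < y / 2 ^ α := by linarith
    rw [max_eq_left (Real.log_nonneg hu.le)]
    have h1 := one_add_log_rpow_le hu.le hα
    have h3 := Real.rpow_le_affine_rpow hy (by linarith : 0 ≤ p + α / 2) hq (by linarith)
    have hr : (2 : ℝ) ^ α ≤ ((2 : ℝ) ^ α) ^ (p + α / 2) := by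
      conv_lhs => rw [← Real.rpow_one (2 ^ α)]
      exact Real.rpow_le_rpow_of_exponent_le h2α (by linarith)
    calc (y / 2 ^ α) ^ p * (1 + Real.log (y / 2 ^ α)) ^ α
        ≤ (y / 2 ^ α) ^ p * (2 ^ α * Real.exp (-(α / 2)) * (y / 2 ^ α) ^ (α / 2)) := by gcongr
      _ = Real.exp (-(α / 2)) * (2 ^ α / (2 ^ α) ^ (p + α / 2)) * y ^ (p + α / 2) := by
          have e : (y / 2 ^ α) ^ p * (y / 2 ^ α) ^ (α / 2)
              = y ^ (p + α / 2) / (2 ^ α) ^ (p + α / 2) := by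
            rw [← Real.rpow_add hu0, Real.div_rpow hy h2.le]
          calc _ = 2 ^ α * Real.exp (-(α / 2)) *
                ((y / 2 ^ α) ^ p * (y / 2 ^ α) ^ (α / 2)) := by ring
            _ = _ := by rw [e]; ring
      _ ≤ Real.exp (-(α / 2)) * 1 * y ^ (p + α / 2) := by
          gcongr
          exact (div_le_one (by positivity)).2 hr
      _ ≤ _ := by
          rw [mul_one]
          gcongr
          refine h3.trans ?_
          gcongr

lemma rpow_div_add_one_le {g Y q : ℝ} (hg : 0 ≤ g) (hgY : g ≤ 1 + Y) (hY : 0 ≤ Y) (hq : 1 ≤ q) :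
    (g / (q + 1)) ^ q ≤ 1 / (q + 1) + q / (q + 1) * (Y ^ q / q ^ q) := by
  have hq0 : 0 < q := by linarith
  have h := (convexOn_rpow hq).2 (Set.mem_Ici.2 zero_le_one)
    (Set.mem_Ici.2 (div_nonneg hY hq0.le)) (show 0 ≤ 1 / (q + 1) by positivity)
    (show 0 ≤ q / (q + 1) by positivity) (by field_simp; ring)
  simp only [smul_eq_mul, Real.one_rpow, mul_one, Real.div_rpow hY hq0.le] at h
  refine le_trans ?_ h
  gcongr
  calc g / (q + 1) ≤ (1 + Y) / (q + 1) := by gcongr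
    _ = _ := by field_simp

lemma MeasureTheory.lintegral_philog_le_of_exp_tail {X : Type*} [MeasurableSpace X]
    {ν : Measure X} {g : X → ℝ} (hg0 : 0 ≤ g) (hg : AEMeasurable g ν)
    (htail : ∀ t > 0, ν {x | 1 + t < g x} ≤ ENNReal.ofReal (Real.exp (-t)) * ν Set.univ)
    {p α : ℝ} (hp : 1 < p) (hα : 0 ≤ α) :
    ∫⁻ x, ENNReal.ofReal (philog p α (g x / (2 ^ α * (p + α + 1)))) ∂ν ≤ ν Set.univ := by
  set q := p + α with hq_def
  have hq : 1 ≤ q := by linarith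
  have hq0 : 0 < q := by linarith
  set E := Real.exp (-(α / 2)) with hE
  have hE0 : 0 < E := Real.exp_pos _
  set ρ := (p + α / 2) / q with hρ
  have hρ0 : 0 < ρ := by positivity
  set a := E * ((1 - p / q) + ρ * (1 / (q + 1))) with ha
  set b := E * ρ * (q / (q + 1)) / q ^ q with hb
  have hθ : p / q ≤ 1 := (div_le_one hq0).2 (by linarith)
  have ha0 : 0 ≤ a := by
    have : 0 ≤ 1 - p / q := by linarith
    positivity
  have hb0 : 0 ≤ b := by positivity
  let Y : X → ℝ := fun x => max (g x - 1) 0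
  have hY0 : 0 ≤ Y := fun x => le_max_right _ _
  have hYm : AEMeasurable Y ν := (hg.sub_const 1).max aemeasurable_const
  have hpt : ∀ x, philog p α (g x / (2 ^ α * (q + 1))) ≤ a + b * Y x ^ q := by
    intro x
    have h1 := philog_div_two_rpow_le hp hα (div_nonneg (hg0 x) (by linarith : 0 ≤ q + 1))
    have h2 := rpow_div_add_one_le (hg0 x)
      (by have := le_max_left (g x - 1) 0; simp only [Y]; linarith) (hY0 x) hq
    rw [div_div, mul_comm (q + 1)] at h1
    refine h1.trans ?_
    calc _ ≤ E * ((1 - p / q) + ρ * (1 / (q + 1) + q / (q + 1) * (Y x ^ q / q ^ q))) := by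
          gcongr
      _ = a + b * Y x ^ q := by rw [ha, hb]; ring
  have hYint := lintegral_rpow_le_of_exp_tail (M := ν Set.univ) hY0 hYm (fun t ht => by
    refine le_trans (measure_mono fun x hx => ?_) (htail t ht)
    have hx' : t < max (g x - 1) 0 := hx
    rcases lt_max_iff.1 hx' with h | h
    · show 1 + t < g x
      linarith
    · linarith) hq0
  have hsum : a + b * Real.Gamma (q + 1) ≤ 1 := by
    have hG := Real.Gamma_add_one_le_rpow_self hq
    have hqq : 0 < q ^ q := by positivity
    calc a + b * Real.Gamma (q + 1) ≤ a + b * q ^ q := by gcongr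
      _ = E * (1 + α / 2 / q) := by
          rw [ha, hb, hρ]
          have : p = q - α := by rw [hq_def]; ring
          rw [this]
          field_simp
          ring
      _ ≤ E * Real.exp (α / 2) := by
          gcongr
          have h1 := Real.add_one_le_exp (α / 2)
          have h2 : α / 2 / q ≤ α / 2 := div_le_self (by positivity) hq
          linarith
      _ = 1 := by rw [hE, ← Real.exp_add]; simp
  calc _ ≤ ∫⁻ x, (ENNReal.ofReal a + ENNReal.ofReal b * ENNReal.ofReal (Y x ^ q)) ∂ν := by
        refine lintegral_mono fun x => ?_
        rw [← ENNReal.ofReal_mul hb0, ← ENNReal.ofReal_add ha0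
          (mul_nonneg hb0 (Real.rpow_nonneg (hY0 x) q))]
        exact ENNReal.ofReal_le_ofReal (hpt x)
    _ = ENNReal.ofReal a * ν Set.univ
          + ENNReal.ofReal b * ∫⁻ x, ENNReal.ofReal (Y x ^ q) ∂ν := by
        rw [lintegral_add_left measurable_const, lintegral_const,
          lintegral_const_mul' _ _ ENNReal.ofReal_ne_top]
    _ ≤ ENNReal.ofReal a * ν Set.univ
          + ENNReal.ofReal b * (ENNReal.ofReal (Real.Gamma (q + 1)) * ν Set.univ) := by gcongr
    _ = ENNReal.ofReal (a + b * Real.Gamma (q + 1)) * ν Set.univ := by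
        have hG0 : 0 ≤ Real.Gamma (q + 1) := Real.Gamma_nonneg_of_nonneg (by linarith)
        rw [ENNReal.ofReal_add ha0 (mul_nonneg hb0 hG0), ENNReal.ofReal_mul hb0]
        ring
    _ ≤ 1 * ν Set.univ := by
        gcongr
        exact ENNReal.ofReal_le_one.2 hsum
    _ = ν Set.univ := one_mul _

theorem IsDoubling.luxNorm_philog_le {n : ℕ} {μ : Measure (Fin n → ℝ)} {c d : ℝ}
    (hμ : IsDoubling μ c d) {p α : ℝ} (hp : 1 < p) (hα : 0 ≤ α) {f : (Fin n → ℝ) → ℝ}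
    (hf : LocallyIntegrable f μ) {B : ℝ} (hB : 0 < B) (hosc : ∀ Q : Cube n, osc μ Q f ≤ B)
    (Q : Cube n) :
    luxNorm (philog p α) μ Q (fun x => f x - cubeAvg μ Q f) ≤
      c * 2 ^ d * Real.exp 1 * 2 ^ α * (p + α + 1) * B := by
  have := hμ.isLocallyFiniteMeasure
  have hc : 0 < c := one_pos.trans_le hμ.1
  have hq : 0 < p + α + 1 := by linarith
  set Λ := c * 2 ^ d * (Real.exp 1 * B) with hΛ
  have hΛ0 : 0 < Λ := by positivity
  refine csInf_le ⟨0, fun l hl => hl.1.le⟩ ⟨by positivity, ?_⟩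
  have h := lintegral_philog_le_of_exp_tail (ν := μ.restrict Q.carrier)
    (g := fun x => |f x - cubeAvg μ Q f| / Λ) (fun x => by positivity) ?_ ?_ hp hα
  · rw [Measure.restrict_apply_univ] at h
    refine le_trans (le_of_eq ?_) h
    refine lintegral_congr fun x => ?_
    rw [div_div]
    congr 3
    rw [hΛ]
    ring
  · have h1 := hf.aestronglyMeasurable.aemeasurable.mono_measure
      (Measure.restrict_le_self (s := Q.carrier))
    exact ((continuous_abs.measurable.comp_aemeasurable (h1.sub_const _))).div_const _
  · intro t ht
    rw [Measure.restrict_apply_univ, Measure.restrict_apply' Q.measurableSet_carrier]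
    have hfl := Nat.floor_le (show 0 ≤ 1 + t by linarith)
    have hfl' := Nat.lt_floor_add_one (1 + t)
    refine le_trans (measure_mono ?_)
      ((hμ.measure_lt_abs_sub_cubeAvg_le hf hB hosc ⌊1 + t⌋₊ Q).trans ?_)
    · rintro x ⟨hx, hxQ⟩
      refine ⟨hxQ, ?_⟩
      have hx' : 1 + t < |f x - cubeAvg μ Q f| / Λ := hx
      rw [lt_div_iff₀ hΛ0] at hx'
      exact lt_of_le_of_lt (by gcongr) hx'
    · gcongr
      linarith

/-- Corollary 1.2: for a doubling measure `μ`, `p > 1` and `α ≥ 0`,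
`‖f − f_{Q,μ}‖_{L^p log^α L(Q, dμ/μ(Q))} ≤ c_μ 2^{n_μ} e 2^α (p + α + 1) ‖f‖_{BMO(dμ)}`
for every cube `Q` and every `f ∈ BMO(dμ)`. -/
theorem statement1 {n : ℕ} (μ : Measure (Fin n → ℝ)) (c d : ℝ) (hμ : IsDoubling μ c d)
    (p α : ℝ) (hp : 1 < p) (hα : 0 ≤ α)
    (f : (Fin n → ℝ) → ℝ) (hf : MemBMO μ f) (Q : Cube n) :
    luxNorm (philog p α) μ Q (fun x => f x - cubeAvg μ Q f) ≤
      c * 2 ^ d * Real.exp 1 * 2 ^ α * (p + α + 1) * bmoNorm μ f := by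
  set K := c * 2 ^ d * Real.exp 1 * 2 ^ α * (p + α + 1) with hK
  have hc : 0 < c := one_pos.trans_le hμ.1
  have hK0 : 0 < K := by
    have : 0 < p + α + 1 := by linarith
    positivity
  have hle : ∀ P : Cube n, osc μ P f ≤ bmoNorm μ f := le_ciSup hf.2
  have h0 : 0 ≤ bmoNorm μ f :=
    (IsDoubling.setAverage_nonneg Q fun x => abs_nonneg (f x - cubeAvg μ Q f)).trans (hle Q)
  refine le_of_forall_pos_le_add fun ε hε => ?_
  have h := hμ.luxNorm_philog_le hp hα hf.1 (B := bmoNorm μ f + ε / K) (by positivity)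
    (fun P => (hle P).trans (le_add_of_nonneg_right (by positivity))) Q
  rwa [← hK, mul_add, mul_div_cancel₀ _ hK0.ne'] at h

end
end

section
/- There exists a constant C(n) > 0 depending only on the dimension n such that for every measurable exponent function p : ℝⁿ → [1,∞) with p⁺ := ess sup p < ∞, every cube Q in ℝⁿ and every f ∈ BMO (with respect to Lebesgue measure): ‖f − f_Q‖_{L^{p(·)}(Q, dx/|Q|)} ≤ C(n) p⁺ ‖f‖_{BMO}. -/
open MeasureTheory Set Filter
open scoped ENNReal

noncomputable section

namespace Cube

variable {n : ℕ}

lemma carrier_eq_Icc (Q : Cube n) :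
    Q.carrier = Icc Q.corner (fun i => Q.corner i + Q.side) := by
  ext x
  simp only [carrier, mem_ofPred_eq, mem_Icc, Pi.le_def, forall_and]

lemma volume_carrier (Q : Cube n) : volume Q.carrier = ENNReal.ofReal (Q.side ^ n) := by
  rw [carrier_eq_Icc, Real.volume_Icc_pi, ENNReal.ofReal_pow Q.side_pos.le]
  simp

lemma volume_real_carrier (Q : Cube n) : volume.real Q.carrier = Q.side ^ n := by
  rw [measureReal_def, volume_carrier, ENNReal.toReal_ofReal (pow_nonneg Q.side_pos.le n)]

/-- The `2 ^ n` dyadic children of a cube. -/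
def child (Q : Cube n) (ε : Fin n → Bool) : Cube n where
  corner i := Q.corner i + if ε i then Q.side / 2 else 0
  side := Q.side / 2
  side_pos := half_pos Q.side_pos

lemma child_subset (Q : Cube n) (ε : Fin n → Bool) : (Q.child ε).carrier ⊆ Q.carrier := by
  intro x hx i
  have h := hx i
  have hs := Q.side_pos
  simp only [child] at h
  split_ifs at h <;> constructor <;> linarith [h.1, h.2]

lemma exists_mem_child (Q : Cube n) {x : Fin n → ℝ} (hx : x ∈ Q.carrier) :
    ∃ ε, x ∈ (Q.child ε).carrier := by
  refine ⟨fun i => decide (Q.corner i + Q.side / 2 ≤ x i), fun i => ?_⟩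
  have h := hx i
  simp only [child, decide_eq_true_eq]
  split_ifs with hi
  · constructor <;> linarith [h.2]
  · constructor <;> linarith [h.1]

lemma aedisjoint_child (Q : Cube n) :
    Pairwise (Function.onFun (AEDisjoint volume) fun ε => (Q.child ε).carrier) := by
  intro ε ε' hne
  obtain ⟨i, hi⟩ := Function.ne_iff.mp hne
  refine measure_mono_null (t := {x | x i = Q.corner i + Q.side / 2}) ?_
    (Measure.pi_hyperplane (fun _ => volume) i _)
  rintro x ⟨h, h'⟩
  have h₁ := h i
  have h₂ := h' i
  simp only [child] at h₁ h₂
  rw [mem_ofPred_eq]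
  cases hε : ε i <;> cases hε' : ε' i <;> simp_all <;> linarith [h₁.1, h₁.2, h₂.1, h₂.2]

lemma sum_child_side (Q : Cube n) : ∑ ε, (Q.child ε).side ^ n = Q.side ^ n := by
  simp only [child, Finset.sum_const, Finset.card_univ, Fintype.card_fun, Fintype.card_bool,
    Fintype.card_fin, nsmul_eq_mul, Nat.cast_pow, Nat.cast_ofNat, div_pow]
  field_simp

lemma sum_setIntegral_child_le (Q : Cube n) {g : (Fin n → ℝ) → ℝ} (hg : ∀ x, 0 ≤ g x)
    (hi : IntegrableOn g Q.carrier) :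
    ∑ ε, ∫ x in (Q.child ε).carrier, g x ≤ ∫ x in Q.carrier, g x := by
  have hsub : ⋃ ε, (Q.child ε).carrier ⊆ Q.carrier := iUnion_subset Q.child_subset
  rw [← tsum_fintype (L := .unconditional _), ← integral_iUnion_ae
    (fun ε => (Q.child ε).measurableSet_carrier.nullMeasurableSet) Q.aedisjoint_child
    (hi.mono_set hsub)]
  exact setIntegral_mono_set hi (Eventually.of_forall hg) hsub.eventuallyLE

end Cube

section JohnNirenberg

variable {n : ℕ} {f : (Fin n → ℝ) → ℝ} {B : ℝ}

lemma integrableOn_abs_sub (hf : LocallyIntegrable f volume) (Q : Cube n) (a : ℝ) :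
    IntegrableOn (fun x => |f x - a|) Q.carrier := by
  refine Integrable.abs (Integrable.sub ?_ ?_)
  · exact hf.integrableOn_isCompact Q.isCompact_carrier
  · exact integrableOn_const Q.isCompact_carrier.measure_lt_top.ne

lemma side_pow_mul_abs_cubeAvg_sub_le (hf : LocallyIntegrable f volume) (Q : Cube n) (a : ℝ) :
    Q.side ^ n * |cubeAvg volume Q f - a| ≤ ∫ x in Q.carrier, |f x - a| := by
  have hs : 0 < Q.side ^ n := pow_pos Q.side_pos n
  have h₁ : Q.side ^ n * (cubeAvg volume Q f - a) = ∫ x in Q.carrier, (f x - a) := by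
    rw [integral_sub (hf.integrableOn_isCompact Q.isCompact_carrier)
      (integrableOn_const Q.isCompact_carrier.measure_lt_top.ne), setIntegral_const,
      cubeAvg, setAverage_eq, Q.volume_real_carrier]
    simp only [smul_eq_mul]
    field_simp
  rw [← abs_of_pos hs, ← abs_mul, h₁]
  exact abs_integral_le_integral_abs

lemma setIntegral_abs_sub_cubeAvg_le (hB : ∀ Q : Cube n, osc volume Q f ≤ B) (Q : Cube n) :
    ∫ x in Q.carrier, |f x - cubeAvg volume Q f| ≤ B * Q.side ^ n := by
  have hs : 0 < Q.side ^ n := pow_pos Q.side_pos n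
  have h := hB Q
  rw [osc, setAverage_eq, Q.volume_real_carrier, smul_eq_mul, inv_mul_le_iff₀ hs] at h
  linarith

lemma abs_cubeAvg_child_sub_le (hf : LocallyIntegrable f volume)
    (hB : ∀ Q : Cube n, osc volume Q f ≤ B) (Q : Cube n) (ε : Fin n → Bool) :
    |cubeAvg volume (Q.child ε) f - cubeAvg volume Q f| ≤ 2 ^ n * B := by
  have hs : 0 < Q.side ^ n := pow_pos Q.side_pos n
  have h₁ := side_pow_mul_abs_cubeAvg_sub_le hf (Q.child ε) (cubeAvg volume Q f)
  have h₂ : ∫ x in (Q.child ε).carrier, |f x - cubeAvg volume Q f| ≤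
      ∫ x in Q.carrier, |f x - cubeAvg volume Q f| :=
    setIntegral_mono_set (integrableOn_abs_sub hf Q _)
      (Eventually.of_forall fun _ => abs_nonneg _) (Q.child_subset ε).eventuallyLE
  have h₃ := h₁.trans (h₂.trans (setIntegral_abs_sub_cubeAvg_le hB Q))
  have h₄ : (Q.child ε).side ^ n = Q.side ^ n / 2 ^ n := div_pow _ _ _
  rw [h₄, div_mul_eq_mul_div, div_le_iff₀ (by positivity)] at h₃
  refine le_of_mul_le_mul_left ?_ hs
  linarith

/-- The integral over `Q` of `exp (lam * |f_m - a|)`, where `f_m` averages `f` over the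
`m`-th generation dyadic subcubes of `Q`. -/
def dyadicExpSum (f : (Fin n → ℝ) → ℝ) (lam a : ℝ) : ℕ → Cube n → ℝ
  | 0, Q => Real.exp (lam * |cubeAvg volume Q f - a|) * Q.side ^ n
  | m + 1, Q => ∑ ε, dyadicExpSum f lam a m (Q.child ε)

/-- A function with integral `dyadicExpSum f lam a m Q` over `Q`, equal almost everywhere to
`exp (lam * |f_m - a|)`. -/
def dyadicExp (f : (Fin n → ℝ) → ℝ) (lam a : ℝ) : ℕ → Cube n → (Fin n → ℝ) → ℝ≥0∞
  | 0, Q => fun _ => ENNReal.ofReal (Real.exp (lam * |cubeAvg volume Q f - a|))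
  | m + 1, Q => fun x =>
      ∑ ε, (Q.child ε).carrier.indicator (dyadicExp f lam a m (Q.child ε)) x

lemma dyadicExpSum_nonneg (lam a : ℝ) (m : ℕ) (Q : Cube n) :
    0 ≤ dyadicExpSum f lam a m Q := by
  induction m generalizing Q with
  | zero => exact mul_nonneg (Real.exp_pos _).le (pow_nonneg Q.side_pos.le n)
  | succ m ih => exact Finset.sum_nonneg fun ε _ => ih _

lemma measurable_dyadicExp (lam a : ℝ) (m : ℕ) (Q : Cube n) :
    Measurable (dyadicExp f lam a m Q) := by
  induction m generalizing Q with
  | zero => exact measurable_const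
  | succ m ih =>
    exact Finset.measurable_sum _ fun ε _ =>
      (ih _).indicator (Q.child ε).measurableSet_carrier

lemma setLIntegral_dyadicExp (lam a : ℝ) (m : ℕ) (Q : Cube n) :
    ∫⁻ x in Q.carrier, dyadicExp f lam a m Q x =
      ENNReal.ofReal (dyadicExpSum f lam a m Q) := by
  induction m generalizing Q with
  | zero =>
    simp only [dyadicExp, dyadicExpSum]
    rw [setLIntegral_const, Q.volume_carrier, ENNReal.ofReal_mul (Real.exp_pos _).le]
  | succ m ih =>
    simp only [dyadicExp, dyadicExpSum]
    rw [lintegral_finsetSum _ fun ε _ =>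
        (measurable_dyadicExp lam a m _).indicator (Q.child ε).measurableSet_carrier,
      ENNReal.ofReal_sum_of_nonneg fun ε _ => dyadicExpSum_nonneg lam a m _]
    refine Finset.sum_congr rfl fun ε _ => ?_
    rw [setLIntegral_indicator (Q.child ε).measurableSet_carrier,
      inter_eq_left.mpr (Q.child_subset ε), ih]

lemma exists_cube_le_dyadicExp (lam a : ℝ) (m : ℕ) (Q : Cube n) {x : Fin n → ℝ}
    (hx : x ∈ Q.carrier) :
    ∃ S : Cube n, S.side = Q.side / 2 ^ m ∧ x ∈ S.carrier ∧
      ENNReal.ofReal (Real.exp (lam * |cubeAvg volume S f - a|)) ≤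
        dyadicExp f lam a m Q x := by
  induction m generalizing Q with
  | zero => exact ⟨Q, by simp, hx, le_rfl⟩
  | succ m ih =>
    obtain ⟨ε, hε⟩ := Q.exists_mem_child hx
    obtain ⟨S, hS, hxS, hle⟩ := ih (Q.child ε) hε
    refine ⟨S, ?_, hxS, hle.trans ?_⟩
    · rw [hS, pow_succ']
      exact div_div _ _ _
    · simp only [dyadicExp]
      rw [← indicator_of_mem hε (dyadicExp f lam a m (Q.child ε))]
      exact Finset.single_le_sum
        (f := fun ε => (Q.child ε).carrier.indicator (dyadicExp f lam a m (Q.child ε)) x)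
        (fun _ _ => zero_le) (Finset.mem_univ ε)

lemma dyadicExpSum_le_exp_mul {lam : ℝ} (hlam : 0 ≤ lam) (a b : ℝ) (m : ℕ) (Q : Cube n) :
    dyadicExpSum f lam a m Q ≤ Real.exp (lam * |b - a|) * dyadicExpSum f lam b m Q := by
  induction m generalizing Q with
  | zero =>
    simp only [dyadicExpSum]
    rw [← mul_assoc, ← Real.exp_add, ← mul_add]
    refine mul_le_mul_of_nonneg_right (Real.exp_le_exp.mpr ?_) (pow_nonneg Q.side_pos.le n)
    refine mul_le_mul_of_nonneg_left ?_ hlam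
    rw [add_comm]
    exact abs_sub_le _ _ _
  | succ m ih =>
    simp only [dyadicExpSum, Finset.mul_sum]
    exact Finset.sum_le_sum fun ε _ => ih _

/-- One step of the stopping-time argument, with stopping level `2 * B` around `a`. -/
lemma dyadicExpSum_le_of_abs_sub_le (hf : LocallyIntegrable f volume) (hB₀ : 0 < B)
    (hB : ∀ Q : Cube n, osc volume Q f ≤ B) {lam : ℝ} (hlam : 0 ≤ lam)
    (hexp : Real.exp (lam * ((2 + 2 ^ n) * B)) ≤ 10 / 9) (m : ℕ) (Q : Cube n) (a : ℝ)
    (ha : |cubeAvg volume Q f - a| ≤ 2 * B) :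
    dyadicExpSum f lam a m Q ≤
      10 / 9 * Q.side ^ n + 25 / 18 / B * ∫ x in Q.carrier, |f x - a| := by
  have hmono : ∀ t, t ≤ (2 + 2 ^ n) * B → Real.exp (lam * t) ≤ 10 / 9 := fun t ht =>
    (Real.exp_le_exp.mpr (mul_le_mul_of_nonneg_left ht hlam)).trans hexp
  have hpow : 0 ≤ 2 ^ n * B := by positivity
  induction m generalizing Q a with
  | zero =>
    have h₁ : 0 ≤ 25 / 18 / B * ∫ x in Q.carrier, |f x - a| :=
      mul_nonneg (by positivity) (integral_nonneg fun _ => abs_nonneg _)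
    have h₂ := mul_le_mul_of_nonneg_right (hmono |cubeAvg volume Q f - a| (by linarith))
      (pow_nonneg Q.side_pos.le n)
    simp only [dyadicExpSum]
    linarith
  | succ m ih =>
    have hchild : ∀ ε, dyadicExpSum f lam a m (Q.child ε) ≤
        10 / 9 * (Q.child ε).side ^ n +
          25 / 18 / B * ∫ x in (Q.child ε).carrier, |f x - a| := by
      intro ε
      set R := Q.child ε
      have hs : 0 ≤ R.side ^ n := pow_nonneg R.side_pos.le n
      rcases le_or_gt |cubeAvg volume R f - a| (2 * B) with h | h
      · exact ih R a h
      · have hjump : |cubeAvg volume R f - a| ≤ (2 + 2 ^ n) * B := by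
          have := abs_sub_le (cubeAvg volume R f) (cubeAvg volume Q f) a
          have := abs_cubeAvg_child_sub_le hf hB Q ε
          linarith
        have hown : dyadicExpSum f lam (cubeAvg volume R f) m R ≤ 5 / 2 * R.side ^ n := by
          have h₁ := ih R (cubeAvg volume R f) (by rw [sub_self, abs_zero]; positivity)
          have h₂ := mul_le_mul_of_nonneg_left (setIntegral_abs_sub_cubeAvg_le hB R)
            (by positivity : 0 ≤ 25 / 18 / B)
          have h₃ : 25 / 18 / B * (B * R.side ^ n) = 25 / 18 * R.side ^ n := by field_simp
          linarith
        have hint : R.side ^ n * (2 * B) ≤ ∫ x in R.carrier, |f x - a| :=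
          (mul_le_mul_of_nonneg_left h.le hs).trans (side_pow_mul_abs_cubeAvg_sub_le hf R a)
        have hint' := mul_le_mul_of_nonneg_left hint (by positivity : 0 ≤ 25 / 18 / B)
        have h₄ : 25 / 18 / B * (R.side ^ n * (2 * B)) = 25 / 9 * R.side ^ n := by
          field_simp
          ring
        calc dyadicExpSum f lam a m R
            ≤ Real.exp (lam * |cubeAvg volume R f - a|) *
                dyadicExpSum f lam (cubeAvg volume R f) m R :=
              dyadicExpSum_le_exp_mul hlam _ _ _ _
          _ ≤ 10 / 9 * (5 / 2 * R.side ^ n) :=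
              mul_le_mul (hmono _ hjump) hown (dyadicExpSum_nonneg _ _ _ _) (by norm_num)
          _ ≤ _ := by linarith
    calc dyadicExpSum f lam a (m + 1) Q
        ≤ ∑ ε, (10 / 9 * (Q.child ε).side ^ n +
            25 / 18 / B * ∫ x in (Q.child ε).carrier, |f x - a|) :=
          Finset.sum_le_sum fun ε _ => hchild ε
      _ = 10 / 9 * Q.side ^ n +
            25 / 18 / B * ∑ ε, ∫ x in (Q.child ε).carrier, |f x - a| := by
          rw [Finset.sum_add_distrib, ← Finset.mul_sum, ← Finset.mul_sum, Q.sum_child_side]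
      _ ≤ _ := by
          have := mul_le_mul_of_nonneg_left
            (Q.sum_setIntegral_child_le (fun _ => abs_nonneg _) (integrableOn_abs_sub hf Q a))
            (by positivity : 0 ≤ 25 / 18 / B)
          linarith

lemma dyadicExpSum_cubeAvg_le (hf : LocallyIntegrable f volume) (hB₀ : 0 < B)
    (hB : ∀ Q : Cube n, osc volume Q f ≤ B) {lam : ℝ} (hlam : 0 ≤ lam)
    (hexp : Real.exp (lam * ((2 + 2 ^ n) * B)) ≤ 10 / 9) (m : ℕ) (Q : Cube n) :
    dyadicExpSum f lam (cubeAvg volume Q f) m Q ≤ 5 / 2 * Q.side ^ n := by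
  have h₁ := dyadicExpSum_le_of_abs_sub_le hf hB₀ hB hlam hexp m Q (cubeAvg volume Q f)
    (by rw [sub_self, abs_zero]; positivity)
  have h₂ := mul_le_mul_of_nonneg_left (setIntegral_abs_sub_cubeAvg_le hB Q)
    (by positivity : 0 ≤ 25 / 18 / B)
  have h₃ : 25 / 18 / B * (B * Q.side ^ n) = 25 / 18 * Q.side ^ n := by field_simp
  linarith

/-- Lebesgue differentiation along cubes containing the point. -/
lemma ae_tendsto_cubeAvg (hf : LocallyIntegrable f volume) :
    ∀ᵐ x, ∀ S : ℕ → Cube n, (∀ m, x ∈ (S m).carrier) →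
      Tendsto (fun m => (S m).side) atTop (nhds 0) →
      Tendsto (fun m => cubeAvg volume (S m) f) atTop (nhds (f x)) := by
  filter_upwards [IsUnifLocDoublingMeasure.ae_tendsto_average (μ := volume) hf 1]
    with x hx S hxS hS
  have h := hx (l := atTop) (fun m i => (S m).corner i + (S m).side / 2)
    (fun m => (S m).side / 2) ?_ ?_
  · simpa only [← Cube.carrier_eq_closedBall, cubeAvg] using h
  · rw [tendsto_nhdsWithin_iff]
    refine ⟨by simpa using hS.div_const 2, Eventually.of_forall fun m => ?_⟩
    exact half_pos (S m).side_pos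
  · refine Eventually.of_forall fun m => ?_
    rw [one_mul, ← Cube.carrier_eq_closedBall]
    exact hxS m

/-- The John–Nirenberg inequality in exponentially integrable form. -/
theorem setLIntegral_exp_abs_sub_cubeAvg_le (hf : LocallyIntegrable f volume) (hB₀ : 0 < B)
    (hB : ∀ Q : Cube n, osc volume Q f ≤ B) {lam : ℝ} (hlam : 0 ≤ lam)
    (hexp : Real.exp (lam * ((2 + 2 ^ n) * B)) ≤ 10 / 9) (Q : Cube n) :
    ∫⁻ x in Q.carrier, ENNReal.ofReal (Real.exp (lam * |f x - cubeAvg volume Q f|)) ≤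
      ENNReal.ofReal (5 / 2) * volume Q.carrier := by
  set a := cubeAvg volume Q f
  have hpt : ∀ᵐ x ∂volume.restrict Q.carrier,
      ENNReal.ofReal (Real.exp (lam * |f x - a|)) ≤
        liminf (fun m => dyadicExp f lam a m Q x) atTop := by
    filter_upwards [ae_restrict_of_ae (ae_tendsto_cubeAvg hf),
      ae_restrict_mem Q.measurableSet_carrier] with x hx hxQ
    choose S hside hxS hle using fun m =>
      exists_cube_le_dyadicExp (f := f) lam a m Q hxQ
    have hside0 : Tendsto (fun m => (S m).side) atTop (nhds 0) := by
      simp only [hside]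
      exact tendsto_const_nhds.div_atTop (tendsto_pow_atTop_atTop_of_one_lt one_lt_two)
    have hlim : Tendsto
        (fun m => ENNReal.ofReal (Real.exp (lam * |cubeAvg volume (S m) f - a|))) atTop
        (nhds (ENNReal.ofReal (Real.exp (lam * |f x - a|)))) :=
      ENNReal.tendsto_ofReal ((Real.continuous_exp.tendsto _).comp
        (((hx S hxS hside0).sub_const a).abs.const_mul lam))
    rw [← hlim.liminf_eq]
    exact liminf_le_liminf (Eventually.of_forall hle)
  calc ∫⁻ x in Q.carrier, ENNReal.ofReal (Real.exp (lam * |f x - a|))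
      ≤ ∫⁻ x in Q.carrier, liminf (fun m => dyadicExp f lam a m Q x) atTop :=
        lintegral_mono_ae hpt
    _ ≤ liminf (fun m => ∫⁻ x in Q.carrier, dyadicExp f lam a m Q x) atTop :=
        lintegral_liminf_le fun m => measurable_dyadicExp lam a m Q
    _ ≤ liminf (fun _ : ℕ => ENNReal.ofReal (5 / 2) * volume Q.carrier) atTop := by
        refine liminf_le_liminf (Eventually.of_forall fun m => ?_)
        simp only [setLIntegral_dyadicExp, Q.volume_carrier]
        rw [← ENNReal.ofReal_mul (by norm_num)]
        exact ENNReal.ofReal_le_ofReal (dyadicExpSum_cubeAvg_le hf hB₀ hB hlam hexp m Q)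
    _ = _ := liminf_const _

end JohnNirenberg

lemma div_rpow_le_exp_sub_one {s p P : ℝ} (hs : 0 ≤ s) (hp : 1 ≤ p) (hP : p ≤ P) :
    (s / P) ^ p ≤ Real.exp (s - 1) := by
  have hp₀ : 0 < p := by linarith
  have h₁ : s / P ≤ Real.exp (s / p - 1) := by
    have := Real.add_one_le_exp (s / p - 1)
    have := div_le_div_of_nonneg_left hs hp₀ hP
    linarith
  calc (s / P) ^ p ≤ Real.exp (s / p - 1) ^ p :=
        Real.rpow_le_rpow (div_nonneg hs (by linarith)) h₁ hp₀.le
    _ = Real.exp (s - p) := by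
        rw [← Real.exp_mul]
        congr 1
        field_simp
    _ ≤ _ := Real.exp_le_exp.mpr (by linarith)

lemma vpLuxNorm_sub_cubeAvg_le {n : ℕ} {f p : (Fin n → ℝ) → ℝ} {B P : ℝ}
    (hf : LocallyIntegrable f volume) (hB₀ : 0 < B) (hB : ∀ Q : Cube n, osc volume Q f ≤ B)
    (hp : ∀ x, 1 ≤ p x) (hP : ∀ᵐ x, p x ≤ P) (hP₀ : 0 < P) (Q : Cube n) :
    vpLuxNorm p Q (fun x => f x - cubeAvg volume Q f) ≤ 10 * (2 + 2 ^ n) * P * B := by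
  refine csInf_le ⟨0, fun _ h => h.1.le⟩ ⟨by positivity, ?_⟩
  set lam : ℝ := (10 * (2 + 2 ^ n) * B)⁻¹ with hlam
  have hlam₀ : 0 < lam := by positivity
  have hexp : Real.exp (lam * ((2 + 2 ^ n) * B)) ≤ 10 / 9 := by
    have h : lam * ((2 + 2 ^ n) * B) = 1 / 10 := by
      rw [hlam]
      field_simp
    rw [h]
    have h₁ := Real.add_one_le_exp (-(1 / 10) : ℝ)
    have h₂ := Real.exp_pos (1 / 10)
    rw [Real.exp_neg, le_inv_comm₀ (by norm_num) h₂] at h₁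
    norm_num at h₁ ⊢
    exact h₁
  calc ∫⁻ x in Q.carrier,
        ENNReal.ofReal ((|f x - cubeAvg volume Q f| / (10 * (2 + 2 ^ n) * P * B)) ^ p x)
      ≤ ∫⁻ x in Q.carrier, ENNReal.ofReal (Real.exp (-1)) *
          ENNReal.ofReal (Real.exp (lam * |f x - cubeAvg volume Q f|)) := by
        refine lintegral_mono_ae ?_
        filter_upwards [ae_restrict_of_ae hP] with x hx
        rw [← ENNReal.ofReal_mul (Real.exp_pos _).le, ← Real.exp_add]
        refine ENNReal.ofReal_le_ofReal ?_
        have h := div_rpow_le_exp_sub_one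
          (mul_nonneg hlam₀.le (abs_nonneg (f x - cubeAvg volume Q f))) (hp x) hx
        convert h using 2
        · rw [hlam]
          field_simp
        · ring
    _ = ENNReal.ofReal (Real.exp (-1)) *
          ∫⁻ x in Q.carrier, ENNReal.ofReal (Real.exp (lam * |f x - cubeAvg volume Q f|)) :=
        lintegral_const_mul' _ _ ENNReal.ofReal_ne_top
    _ ≤ ENNReal.ofReal (Real.exp (-1)) * (ENNReal.ofReal (5 / 2) * volume Q.carrier) := by
        gcongr
        exact setLIntegral_exp_abs_sub_cubeAvg_le hf hB₀ hB hlam₀.le hexp Q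
    _ ≤ 1 * volume Q.carrier := by
        rw [← mul_assoc, ← ENNReal.ofReal_mul (Real.exp_pos _).le]
        gcongr
        rw [ENNReal.ofReal_le_one, Real.exp_neg, inv_mul_le_iff₀ (Real.exp_pos _)]
        linarith [Real.exp_one_gt_d9]
    _ = volume Q.carrier := one_mul _

/-- Corollary 1.3: there is a dimensional constant `C(n) > 0` such that for every
measurable exponent function `p : ℝⁿ → [1,∞)` with essential upper bound `p⁺ < ∞`,
every cube `Q` and every `f ∈ BMO`,
`‖f − f_Q‖_{L^{p(·)}(Q, dx/|Q|)} ≤ C(n) p⁺ ‖f‖_{BMO}`. -/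
theorem statement2 (n : ℕ) :
    ∃ C : ℝ, 0 < C ∧
      ∀ p : (Fin n → ℝ) → ℝ, Measurable p → (∀ x, 1 ≤ p x) →
      ∀ pplus : ℝ, (∀ᵐ x ∂(volume : Measure (Fin n → ℝ)), p x ≤ pplus) →
      ∀ f : (Fin n → ℝ) → ℝ, MemBMO volume f → ∀ Q : Cube n,
        vpLuxNorm p Q (fun x => f x - cubeAvg volume Q f) ≤
          C * pplus * bmoNorm volume f := by
  refine ⟨10 * (2 + 2 ^ n), by positivity, fun p _ hp P hP f hf Q => ?_⟩
  have hP₀ : 0 < P := by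
    obtain ⟨x, hx⟩ := hP.exists
    linarith [hp x]
  refine le_of_forall_pos_le_add fun δ hδ => ?_
  have hc : 0 < 10 * (2 + 2 ^ n) * P := by positivity
  have hosc : ∀ R : Cube n, osc volume R f ≤ bmoNorm volume f := fun R => le_ciSup hf.2 R
  have hnn : 0 ≤ bmoNorm volume f := by
    refine le_trans ?_ (hosc Q)
    rw [osc, setAverage_eq]
    exact smul_nonneg (by positivity) (integral_nonneg fun _ => abs_nonneg _)
  have hγ : 0 < δ / (10 * (2 + 2 ^ n) * P) := by positivity
  have h := vpLuxNorm_sub_cubeAvg_le (B := bmoNorm volume f + δ / (10 * (2 + 2 ^ n) * P))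
    hf.1 (by linarith) (fun R => (hosc R).trans (by linarith)) hp hP hP₀ Q
  rwa [mul_add, mul_div_cancel₀ δ hc.ne'] at h

end
end

section
/- Let μ be a doubling measure on ℝⁿ and let φ be a quasi-submultiplicative Young function with constant c > 0. Let Q be a cube in ℝⁿ, {Q_j}_{j∈ℕ} a countable pairwise-disjoint family of subcubes of Q, and {h_j}_{j∈ℕ} nonnegative measurable functions satisfying (1/μ(Q_j)) ∫_{Q_j} φ(h_j) dμ ≤ 1 for every j. Then ‖Σ_{j∈ℕ} h_j χ_{Q_j}‖_{φ(L)(Q, dμ/μ(Q))} ≤ c ‖Σ_{j∈ℕ} χ_{Q_j}‖_{φ(L)(Q, dμ/μ(Q))}. -/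
open MeasureTheory Set Filter
open scoped ENNReal

noncomputable section

/-- A Young function: convex on `[0,∞)` with `φ(0) = 0`, `φ(1) = 1` and `φ(t) → ∞`. -/
def IsYoung (φ : ℝ → ℝ) : Prop :=
  ConvexOn ℝ (Set.Ici 0) φ ∧ φ 0 = 0 ∧ φ 1 = 1 ∧ Tendsto φ atTop atTop

/-- The cube as an order interval. -/
theorem Cube.carrier_eq_Icc_s8 {n : ℕ} (Q : Cube n) :
    Q.carrier = Set.Icc Q.corner (fun i => Q.corner i + Q.side) := by
  ext x
  simp only [Cube.carrier, Set.mem_ofPred_eq, Set.mem_Icc, Pi.le_def]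
  exact forall_and

theorem Cube.measurableSet_carrier_s8 {n : ℕ} (Q : Cube n) : MeasurableSet Q.carrier := by
  rw [Q.carrier_eq_Icc_s8]
  exact measurableSet_Icc

/-- On a member of a pairwise disjoint family, a sum of indicators reduces to one term. -/
theorem tsum_indicator_of_mem {ι α : Type*} {s : ι → Set α}
    (hs : Pairwise fun i j => Disjoint (s i) (s j)) (f : ι → α → ℝ) {i : ι} {x : α}
    (hx : x ∈ s i) : ∑' j, (s j).indicator (f j) x = f i x := by
  rw [tsum_eq_single i, Set.indicator_of_mem hx]
  intro j hj
  exact Set.indicator_of_notMem (fun hxj => Set.disjoint_left.mp (hs hj) hxj hx) _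

theorem tsum_indicator_of_notMem_iUnion {ι α : Type*} {s : ι → Set α} (f : ι → α → ℝ) {x : α}
    (hx : x ∉ ⋃ i, s i) : ∑' j, (s j).indicator (f j) x = 0 := by
  have h0 : ∀ j, (s j).indicator (f j) x = 0 := fun j =>
    Set.indicator_of_notMem (fun hxj => hx (Set.mem_iUnion.mpr ⟨j, hxj⟩)) _
  simp [h0]

theorem IsYoung.map_mul_le {φ : ℝ → ℝ} (hφ : IsYoung φ) {a t : ℝ} (ha : 0 ≤ a) (ha1 : a ≤ 1)
    (ht : 0 ≤ t) : φ (a * t) ≤ a * φ t := by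
  obtain ⟨hconv, h0, -, -⟩ := hφ
  have := hconv.2 (x := t) (y := 0) ht (Set.mem_Ici.mpr le_rfl) ha (sub_nonneg.mpr ha1)
    (by ring)
  simpa [h0] using this

/-- A quasi-submultiplicative Young function is automatically nonnegative. -/
theorem IsYoung.nonneg {φ : ℝ → ℝ} (hφ : IsYoung φ) {c : ℝ} (hc : 0 < c)
    (hsub : ∀ t₁ t₂ : ℝ, 0 ≤ t₁ → 0 ≤ t₂ → φ (t₁ * t₂) ≤ c * φ t₁ * φ t₂)
    {t : ℝ} (ht : 0 ≤ t) : 0 ≤ φ t := by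
  have one_le : ∀ s : ℝ, 1 ≤ s → 0 ≤ φ s := by
    intro s hs
    have hs0 : 0 < s := by linarith
    have := hφ.map_mul_le (inv_nonneg.mpr hs0.le) (inv_le_one_of_one_le₀ hs) hs0.le
    rw [inv_mul_cancel₀ hs0.ne', hφ.2.2.1] at this
    by_contra! hneg
    linarith [mul_neg_of_pos_of_neg (inv_pos.mpr hs0) hneg]
  rcases le_total 1 t with h1 | h1
  · exact one_le t h1
  rcases ht.eq_or_lt with rfl | ht
  · exact hφ.2.1.ge
  have hle := hsub t t⁻¹ ht.le (inv_nonneg.mpr ht.le)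
  rw [mul_inv_cancel₀ ht.ne', hφ.2.2.1] at hle
  have hinv := one_le t⁻¹ ((one_le_inv₀ ht).mpr h1)
  by_contra! hneg
  linarith [mul_nonpos_of_nonpos_of_nonneg (mul_neg_of_pos_of_neg hc hneg).le hinv]

theorem IsYoung.one_le_of_quasiSubmultiplicative {φ : ℝ → ℝ} (hφ : IsYoung φ) {c : ℝ}
    (hsub : ∀ t₁ t₂ : ℝ, 0 ≤ t₁ → 0 ≤ t₂ → φ (t₁ * t₂) ≤ c * φ t₁ * φ t₂) : 1 ≤ c := by
  simpa [hφ.2.2.1] using hsub 1 1 zero_le_one zero_le_one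

theorem IsYoung.map_div_mul_le {φ : ℝ → ℝ} (hφ : IsYoung φ) {c : ℝ}
    (hsub : ∀ t₁ t₂ : ℝ, 0 ≤ t₁ → 0 ≤ t₂ → φ (t₁ * t₂) ≤ c * φ t₁ * φ t₂)
    {t l : ℝ} (ht : 0 ≤ t) (hl : 0 < l) : φ (t / (c * l)) ≤ φ (1 / l) * φ t := by
  have hc := hφ.one_le_of_quasiSubmultiplicative hsub
  have hc0 : 0 < c := by linarith
  calc φ (t / (c * l)) = φ (c⁻¹ * (1 / l * t)) := by congr 1; field_simp
    _ ≤ c⁻¹ * φ (1 / l * t) :=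
        hφ.map_mul_le (inv_nonneg.mpr hc0.le) (inv_le_one_of_one_le₀ hc) (by positivity)
    _ ≤ c⁻¹ * (c * φ (1 / l) * φ t) := by
        gcongr
        exact hsub _ _ (by positivity) ht
    _ = φ (1 / l) * φ t := by field_simp

/-- Lemma 4.3 (reduction to characteristic functions): for a quasi-submultiplicative
Young function `φ` with constant `csub`, a cube `Q`, a countable pairwise-disjoint
family `{Q_j}` of subcubes of `Q` and nonnegative `h_j` with
`(1/μ(Q_j)) ∫_{Q_j} φ(h_j) dμ ≤ 1`, one has
`‖Σ_j h_j χ_{Q_j}‖_{φ(L)(Q, dμ/μ(Q))} ≤ csub ‖Σ_j χ_{Q_j}‖_{φ(L)(Q, dμ/μ(Q))}`. -/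
theorem statement8 {n : ℕ} (μ : Measure (Fin n → ℝ)) (c d : ℝ) (hμ : IsDoubling μ c d)
    (φ : ℝ → ℝ) (hφ : IsYoung φ) (csub : ℝ) (hcsub : 0 < csub)
    (hqsub : ∀ t₁ t₂ : ℝ, 0 ≤ t₁ → 0 ≤ t₂ → φ (t₁ * t₂) ≤ csub * φ t₁ * φ t₂)
    (Q : Cube n) (J : Set ℕ) (Qj : ℕ → Cube n)
    (hsub : ∀ j ∈ J, (Qj j).carrier ⊆ Q.carrier)
    (hdisj : J.Pairwise fun i j => Disjoint (Qj i).carrier (Qj j).carrier)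
    (h : ℕ → (Fin n → ℝ) → ℝ)
    (hh : ∀ j ∈ J, (∀ x, 0 ≤ h j x) ∧ Measurable (h j) ∧
      ∫⁻ x in (Qj j).carrier, ENNReal.ofReal (φ (h j x)) ∂μ ≤ μ (Qj j).carrier) :
    luxNorm φ μ Q (fun x => ∑' j : J, Set.indicator (Qj (j : ℕ)).carrier (h (j : ℕ)) x) ≤
      csub * luxNorm φ μ Q
        (fun x => ∑' j : J, Set.indicator (Qj (j : ℕ)).carrier (fun _ => (1 : ℝ)) x) := by
  have hdisj' : Pairwise fun i j : J => Disjoint (Qj i).carrier (Qj j).carrier :=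
    fun i j hij => hdisj i.2 j.2 (Subtype.coe_injective.ne hij)
  have hmeas : ∀ j : J, MeasurableSet (Qj j).carrier := fun j => (Qj j).measurableSet_carrier_s8
  set U : Set (Fin n → ℝ) := ⋃ j : J, (Qj j).carrier with hU
  have hUmeas : MeasurableSet U := MeasurableSet.iUnion hmeas
  have hUQ : U ⊆ Q.carrier := Set.iUnion_subset fun j => hsub j j.2
  have hone : ∀ x ∈ U,
      ∑' j : J, Set.indicator (Qj (j : ℕ)).carrier (fun _ => (1 : ℝ)) x = 1 := by
    intro x hx
    obtain ⟨j, hj⟩ := Set.mem_iUnion.mp hx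
    exact tsum_indicator_of_mem (s := fun j : J => (Qj j).carrier) hdisj'
      (fun _ _ => (1 : ℝ)) hj
  have hzero : ∀ (f : ℕ → (Fin n → ℝ) → ℝ) {x}, x ∉ U →
      ∑' j : J, Set.indicator (Qj (j : ℕ)).carrier (f j) x = 0 := fun f _ hx =>
    tsum_indicator_of_notMem_iUnion (s := fun j : J => (Qj j).carrier) (fun j : J => f j) hx
  have hφ0 := hφ.2.1
  have hφ1 := hφ.2.2.1
  unfold luxNorm
  rw [← div_le_iff₀' hcsub]
  apply le_csInf
  · refine ⟨1, one_pos, ?_⟩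
    calc _ ≤ ∫⁻ _ in Q.carrier, 1 ∂μ := by
          refine lintegral_mono fun x => ?_
          by_cases hx : x ∈ U
          · simp [hone x hx, hφ1]
          · simp [hzero (fun _ _ => 1) hx, hφ0]
      _ = μ Q.carrier := by simp
  · rintro l ⟨hl, hint⟩
    rw [div_le_iff₀' hcsub]
    refine csInf_le ⟨0, fun _ h => h.1.le⟩ ⟨mul_pos hcsub hl, le_trans ?_ hint⟩
    set G : (Fin n → ℝ) → ℝ≥0∞ := fun x => ENNReal.ofReal
      (φ (|∑' j : J, Set.indicator (Qj (j : ℕ)).carrier (h (j : ℕ)) x| / (csub * l))) with hG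
    have hGle : ∀ j : J, ∀ x ∈ (Qj j).carrier,
        G x ≤ ENNReal.ofReal (φ (1 / l)) * ENNReal.ofReal (φ (h j x)) := by
      intro j x hx
      have hpos := (hh j j.2).1 x
      rw [← ENNReal.ofReal_mul (hφ.nonneg hcsub hqsub (by positivity)), hG]
      dsimp only
      rw [tsum_indicator_of_mem (s := fun j : J => (Qj j).carrier) hdisj'
        (fun j : J => h j) hx, abs_of_nonneg hpos]
      exact ENNReal.ofReal_le_ofReal (hφ.map_div_mul_le hqsub hpos hl)
    calc ∫⁻ x in Q.carrier, G x ∂μ ≤ ∫⁻ x, G x ∂μ := setLIntegral_le_lintegral _ _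
      _ = ∫⁻ x, U.indicator G x ∂μ := by
          congr 1
          ext x
          by_cases hx : x ∈ U
          · rw [Set.indicator_of_mem hx]
          · simp [hG, Set.indicator_of_notMem hx, hzero h hx, hφ0]
      _ = ∫⁻ x in U, G x ∂μ := lintegral_indicator hUmeas _
      _ = ∑' j : J, ∫⁻ x in (Qj j).carrier, G x ∂μ := lintegral_iUnion hmeas hdisj' _
      _ ≤ ∑' j : J, ENNReal.ofReal (φ (1 / l)) * μ (Qj j).carrier := by
          refine ENNReal.tsum_le_tsum fun j => ?_
          refine (setLIntegral_mono' (hmeas j) (hGle j)).trans ?_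
          rw [lintegral_const_mul' _ _ ENNReal.ofReal_ne_top]
          gcongr
          exact (hh j j.2).2.2
      _ = ∫⁻ _ in U, ENNReal.ofReal (φ (1 / l)) ∂μ := by
          rw [ENNReal.tsum_mul_left, setLIntegral_const, hU, measure_iUnion hdisj' hmeas]
      _ = ∫⁻ x in U, ENNReal.ofReal (φ (|∑' j : J,
            Set.indicator (Qj (j : ℕ)).carrier (fun _ => (1 : ℝ)) x| / l)) ∂μ := by
          refine setLIntegral_congr_fun hUmeas fun x hx => ?_
          simp only [hone x hx, abs_one]
      _ ≤ _ := lintegral_mono_set hUQ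


end
end
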